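/- arXiv:1601.01103 — 3 statements merged into one kernel-verified Lean document; each statement's English description precedes it below -/
import Mathlib

section
/- Let R be a chain ring with maximal ideal P and set of zero-divisors Z. Define an R-module H as follows: if R is an IF-ring, fix 0 ≠ r ∈ P and let H = E(R/rR); if R is not an IF-ring, fix x ∈ E(R/Z) with (0:x) = Z and let H = E(R/Z)/Rx. Then H is FP-injective, and for each nonzero r ∈ R there exists h ∈ H such that the annihilator (0:h) equals Rr. -/
open CategoryTheory

universe u

/-- A chain ring: the lattice of ideals is totally ordered by inclusion. -/
def IsChainRing (R : Type u) [CommRing R] : Prop :=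
  ∀ I J : Ideal R, I ≤ J ∨ J ≤ I

/-- The set of zero-divisors of `R`. -/
def zeroDivisorsSet (R : Type u) [CommRing R] : Set R :=
  {r : R | ∃ s : R, s ≠ 0 ∧ r * s = 0}

/-- An `R`-module `E` is FP-injective if `Ext¹_R(F, E) = 0` for every finitely
presented `R`-module `F`. -/
def IsFPInjective (R : Type u) [CommRing R] (E : Type u) [AddCommGroup E] [Module R E] : Prop :=
  ∀ F : ModuleCat.{u} R, Module.FinitePresentation R F →
    Limits.IsZero (((Ext R (ModuleCat.{u} R) 1).obj (Opposite.op F)).obj (ModuleCat.of R E))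

/-- A submodule `D ≤ E` is pure if `0 → D ⊗ N → E ⊗ N` is exact for every module `N`,
i.e. the sequence `0 → D → E → E/D → 0` remains exact after tensoring with any module. -/
def IsPureSubmodule {R : Type u} [CommRing R] {E : Type u} [AddCommGroup E] [Module R E]
    (D : Submodule R E) : Prop :=
  ∀ (N : Type u) [AddCommGroup N] [Module R N],
    Function.Injective (LinearMap.rTensor N D.subtype)

/-- An `R`-module `G` is almost FP-injective if `G ≅ E/D` for some FP-injective module `E`
and pure submodule `D` of `E`. -/
def IsAlmostFPInjective (R : Type u) [CommRing R] (G : Type u) [AddCommGroup G]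
    [Module R G] : Prop :=
  ∃ (E : Type u) (_ : AddCommGroup E) (_ : Module R E) (D : Submodule R E),
    IsFPInjective R E ∧ IsPureSubmodule D ∧ Nonempty ((E ⧸ D) ≃ₗ[R] G)

/-- The weak dimension of a module, as an element of `ℕ∞`: the least `n` such that
`Tor_{n+1}(M, N) = 0` for all modules `N` (and `⊤ = ∞` if there is no such `n`). -/
noncomputable def weakDim (R : Type u) [CommRing R] (M : Type u) [AddCommGroup M]
    [Module R M] : ℕ∞ :=
  sInf {n : ℕ∞ | ∃ k : ℕ, n = k ∧ ∀ N : ModuleCat.{u} R,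
    Limits.IsZero (((Tor (ModuleCat.{u} R) (k + 1)).obj (ModuleCat.of R M)).obj N)}

/-- The projective dimension of a module, as an element of `ℕ∞`: the least `n` such that
`Ext^{n+1}(M, N) = 0` for all modules `N` (and `⊤ = ∞` if there is no such `n`). -/
noncomputable def projDim (R : Type u) [CommRing R] (M : Type u) [AddCommGroup M]
    [Module R M] : ℕ∞ :=
  sInf {n : ℕ∞ | ∃ k : ℕ, n = k ∧ ∀ N : ModuleCat.{u} R,
    Limits.IsZero (((Ext R (ModuleCat.{u} R) (k + 1)).obj
      (Opposite.op (ModuleCat.of R M))).obj N)}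

/-- An IF-ring: every injective module is flat. -/
def IsIFRing (R : Type u) [CommRing R] : Prop :=
  ∀ (M : Type u) [AddCommGroup M] [Module R M], Module.Injective R M → Module.Flat R M

/-- A semicoherent ring: `Hom_R(E, F)` embeds into a flat module for every pair of
injective modules `E`, `F`. -/
def IsSemicoherent (R : Type u) [CommRing R] : Prop :=
  ∀ (E F : Type u) [AddCommGroup E] [Module R E] [AddCommGroup F] [Module R F],
    Module.Injective R E → Module.Injective R F →
      ∃ (W : Type u) (_ : AddCommGroup W) (_ : Module R W),
        Module.Flat R W ∧ ∃ f : (E →ₗ[R] F) →ₗ[R] W, Function.Injective f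

/-- A coherent ring: every finitely generated ideal is finitely presented. -/
def IsCoherentRing (R : Type u) [CommRing R] : Prop :=
  ∀ I : Ideal R, I.FG → Module.FinitePresentation R I

/-- `i : M →ₗ[R] E` exhibits `E` as an injective hull of `M`: `E` is injective and
`i` is an essential embedding. -/
def IsInjectiveHull (R : Type u) [CommRing R] (M E : Type u) [AddCommGroup M] [Module R M]
    [AddCommGroup E] [Module R E] (i : M →ₗ[R] E) : Prop :=
  Module.Injective R E ∧ Function.Injective i ∧
    ∀ K : Submodule R E, K ≠ ⊥ → K ⊓ LinearMap.range i ≠ ⊥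

/-- The bottom prime ideal `M_♯` (as a set): elements killing some nonzero element of `M`. -/
def bottomSet (R : Type u) [CommRing R] (M : Type u) [AddCommGroup M] [Module R M] : Set R :=
  {s : R | ∃ x : M, x ≠ 0 ∧ s • x = 0}

/-- The top prime ideal `M^♯` (as a set): elements `s` with `sM ⊊ M`. -/
def topSet (R : Type u) [CommRing R] (M : Type u) [AddCommGroup M] [Module R M] : Set R :=
  {s : R | ¬ Function.Surjective fun x : M => s • x}

/-- The module `H` of the paper: if `R` is an IF-ring, `H = E(R/rR)` for some `0 ≠ r ∈ P`;
if `R` is not an IF-ring, `H = E(R/Z)/Rx` for some `x ∈ E(R/Z)` with `(0 : x) = Z`,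
where `Z` is the ideal of zero-divisors of `R`. -/
def IsHModule (R : Type u) [CommRing R] [IsLocalRing R] (Z : Ideal R)
    (H : Type u) [AddCommGroup H] [Module R H] : Prop :=
  (IsIFRing R ∧ ∃ r : R, r ≠ 0 ∧ r ∈ IsLocalRing.maximalIdeal R ∧
      ∃ i : (R ⧸ Ideal.span {r}) →ₗ[R] H, IsInjectiveHull R (R ⧸ Ideal.span {r}) H i) ∨
  (¬ IsIFRing R ∧ ∃ (E : Type u) (_ : AddCommGroup E) (_ : Module R E)
      (i : (R ⧸ Z) →ₗ[R] E) (x : E), IsInjectiveHull R (R ⧸ Z) E i ∧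
      Ideal.torsionOf R E x = Z ∧
      Nonempty ((E ⧸ Submodule.span R {x}) ≃ₗ[R] H))

section LinearExtension

variable {R M N H : Type*} [CommRing R] [AddCommGroup M] [Module R M]
  [AddCommGroup N] [Module R N] [AddCommGroup H] [Module R H]

lemma LinearMap.exists_comp_eq_of_surjective (T : M →ₗ[R] N) (hT : Function.Surjective T)
    (S : M →ₗ[R] H) (h : LinearMap.ker T ≤ LinearMap.ker S) :
    ∃ ψ : N →ₗ[R] H, ∀ m, ψ (T m) = S m := by
  refine ⟨(LinearMap.ker T).liftQ S h ∘ₗ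
    (T.quotKerEquivOfSurjective hT).symm.toLinearMap, fun m ↦ ?_⟩
  have : (T.quotKerEquivOfSurjective hT).symm (T m) = (LinearMap.ker T).mkQ m := by
    rw [LinearEquiv.symm_apply_eq]
    rfl
  simp [this]

end LinearExtension

lemma Module.Injective.exists_extension {R M N E : Type u} [CommRing R] [AddCommGroup M]
    [Module R M] [AddCommGroup N] [Module R N] [AddCommGroup E] [Module R E]
    (hE : Module.Injective R E) (f : M →ₗ[R] N) (g : M →ₗ[R] E)
    (h : LinearMap.ker f ≤ LinearMap.ker g) : ∃ k : N →ₗ[R] E, ∀ m, k (f m) = g m := by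
  obtain ⟨k, hk⟩ := hE.out ((LinearMap.ker f).liftQ f le_rfl)
    (LinearMap.ker_eq_bot.mp (Submodule.ker_liftQ_eq_bot _ _ _ le_rfl))
    ((LinearMap.ker f).liftQ g h)
  exact ⟨k, fun m ↦ by simpa using hk ((LinearMap.ker f).mkQ m)⟩

/-- A module `M` is P-injective if every linear map from a principal ideal `Ra` to `M` extends
to `R`. Such a map amounts to an element of `M` killed by the annihilator of `a`. -/
def IsPInjective (R M : Type*) [CommRing R] [AddCommGroup M] [Module R M] : Prop :=
  ∀ (a : R) (m : M), (∀ s : R, s * a = 0 → s • m = 0) → ∃ z : M, a • z = m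

lemma IsPInjective.of_injective {R M : Type u} [CommRing R] [AddCommGroup M] [Module R M]
    (hM : Module.Injective R M) : IsPInjective R M := by
  intro a m h
  obtain ⟨k, hk⟩ := hM.exists_extension (LinearMap.toSpanSingleton R R a)
    (LinearMap.toSpanSingleton R M m) (fun s hs ↦ by simpa using h s (by simpa using hs))
  refine ⟨k 1, ?_⟩
  simpa [← map_smul] using hk 1

lemma IsPInjective.of_equiv {R M N : Type*} [CommRing R] [AddCommGroup M] [Module R M]
    [AddCommGroup N] [Module R N] (e : M ≃ₗ[R] N) (hM : IsPInjective R M) :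
    IsPInjective R N := by
  intro a n h
  obtain ⟨z, hz⟩ := hM a (e.symm n) (fun s hs ↦ by rw [← map_smul, h s hs, map_zero])
  exact ⟨e z, by rw [← map_smul, hz, e.apply_symm_apply]⟩

lemma torsionOf_eq_span_singleton_of_forall {R M : Type*} [CommRing R] [AddCommGroup M]
    [Module R M] {r : R} {m : M} (h : r • m = 0) (h' : ∀ y : R, y • m = 0 → r ∣ y) :
    Ideal.torsionOf R M m = Ideal.span {r} := by
  ext y
  rw [Ideal.mem_torsionOf_iff, Ideal.mem_span_singleton]
  refine ⟨h' y, ?_⟩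
  rintro ⟨t, rfl⟩
  rw [mul_comm, mul_smul, h, smul_zero]

namespace IsChainRing

variable {R : Type u} [CommRing R]

lemma dvd_total (hR : IsChainRing R) (a b : R) : a ∣ b ∨ b ∣ a := by
  rcases hR (Ideal.span {a}) (Ideal.span {b}) with h | h
  · exact .inr (Ideal.span_singleton_le_span_singleton.mp h)
  · exact .inl (Ideal.span_singleton_le_span_singleton.mp h)

lemma exists_dvd_forall (hR : IsChainRing R) {ι : Type*} [Finite ι] [Nonempty ι] (f : ι → R) :
    ∃ i, ∀ j, f i ∣ f j := by
  have hd : Directed (· ≤ ·) fun i ↦ Ideal.span {f i} := fun i j ↦ by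
    rcases hR (Ideal.span {f i}) (Ideal.span {f j}) with h | h
    · exact ⟨j, h, le_rfl⟩
    · exact ⟨i, le_rfl, h⟩
  obtain ⟨i, hi⟩ := hd.finite_le id
  exact ⟨i, fun j ↦ Ideal.span_singleton_le_span_singleton.mp (hi j)⟩

lemma exists_eq_span_singleton_of_fg (hR : IsChainRing R) {I : Ideal R} (hI : I.FG) :
    ∃ a, I = Ideal.span {a} := by
  obtain ⟨n, v, rfl⟩ := Submodule.fg_iff_exists_fin_generating_family.mp hI
  rcases isEmpty_or_nonempty (Fin n) with _ | _
  · exact ⟨0, by simp⟩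
  · obtain ⟨i, hi⟩ := hR.exists_dvd_forall v
    refine ⟨v i, le_antisymm ?_ ?_⟩
    · rw [Submodule.span_le]
      rintro _ ⟨j, rfl⟩
      exact Ideal.mem_span_singleton.mpr (hi j)
    · exact Submodule.span_mono (by simp)

/-- Over a chain ring, a finite linear system over a P-injective module is solvable
as soon as it is compatible. -/
lemma exists_solution (hR : IsChainRing R) {M : Type*} [AddCommGroup M] [Module R M]
    (hM : IsPInjective R M) {ι : Type*} [Fintype ι] (n : ℕ) (A : ι → Fin n → R) (h : ι → M)
    (hA : ∀ c : ι → R, (∀ j, ∑ i, c i * A i j = 0) → ∑ i, c i • h i = 0) :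
    ∃ y : Fin n → M, ∀ i, ∑ j, A i j • y j = h i := by
  classical
  induction n generalizing h with
  | zero =>
    refine ⟨fun _ ↦ 0, fun i ↦ ?_⟩
    simpa [Pi.single_apply, ite_smul, eq_comm] using
      hA (Pi.single i 1) (fun j ↦ j.elim0)
  | succ n ih =>
    rcases isEmpty_or_nonempty ι with _ | _
    · exact ⟨fun _ ↦ 0, fun i ↦ isEmptyElim i⟩
    obtain ⟨⟨i₀, j₀⟩, hdvd⟩ := hR.exists_dvd_forall fun p : ι × Fin (n + 1) ↦ A p.1 p.2
    choose c hc using fun i ↦ hdvd (i, j₀)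
    choose b hb using fun j ↦ hdvd (i₀, j)
    dsimp only at hc hb
    set a := A i₀ j₀ with ha
    obtain ⟨y, hy⟩ := ih (fun i j ↦ A i (j₀.succAbove j) - c i * A i₀ (j₀.succAbove j))
      (fun i ↦ h i - c i • h i₀) (by
        intro d hd
        have := hA (d - Pi.single i₀ (∑ i, d i * c i)) (fun j ↦ by
          have hsum : ∑ i, (d - Pi.single i₀ (∑ i, d i * c i) : ι → R) i * A i j
              = ∑ i, d i * (A i j - c i * A i₀ j) := by
            simp [sub_mul, mul_sub, Finset.sum_sub_distrib, Pi.single_apply, ite_mul,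
              Finset.sum_mul, mul_assoc]
          rw [hsum]
          rcases Fin.eq_self_or_eq_succAbove j₀ j with rfl | ⟨k, rfl⟩
          · refine Finset.sum_eq_zero fun i _ ↦ ?_
            rw [hc i, ← ha]
            ring
          · exact hd k)
        rw [← this]
        simp [sub_smul, smul_sub, Finset.sum_sub_distrib, Pi.single_apply, ite_smul,
          Finset.sum_smul, mul_smul])
    obtain ⟨z, hz⟩ := hM a (h i₀) (fun s hs ↦ by
      have := hA (Pi.single i₀ s) (fun j ↦ by
        simp only [Pi.single_apply, ite_mul, zero_mul, Finset.sum_ite_eq', Finset.mem_univ,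
          if_true]
        rw [hb j, ← mul_assoc, hs, zero_mul])
      simpa [Pi.single_apply, ite_smul] using this)
    refine ⟨j₀.insertNth (z - ∑ j, b (j₀.succAbove j) • y j) y, fun i ↦ ?_⟩
    have hi := hy i
    rw [Fin.sum_univ_succAbove _ j₀]
    simp only [Fin.insertNth_apply_same, Fin.insertNth_apply_succAbove]
    have h₁ : ∑ j, A i₀ (j₀.succAbove j) • y j = a • ∑ j, b (j₀.succAbove j) • y j := by
      rw [Finset.smul_sum]
      exact Finset.sum_congr rfl fun j _ ↦ by rw [hb (j₀.succAbove j), mul_smul]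
    have h₂ : ∑ j, A i (j₀.succAbove j) • y j
        = h i - c i • h i₀ + c i • ∑ j, A i₀ (j₀.succAbove j) • y j := by
      rw [← hi, Finset.smul_sum, ← Finset.sum_add_distrib]
      exact Finset.sum_congr rfl fun j _ ↦ by rw [smul_smul, ← add_smul, sub_add_cancel]
    rw [h₂, h₁, hc i, mul_comm a, mul_smul, smul_sub, hz, smul_sub]
    abel

lemma exists_factorization (hR : IsChainRing R) {H : Type*} [AddCommGroup H] [Module R H]
    (hH : IsPInjective R H) {P M F : Type*} [AddCommGroup P] [Module R P] [AddCommGroup M]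
    [Module R M] [AddCommGroup F] [Module R F] [Module.FinitePresentation R F]
    (d : P →ₗ[R] M) (p : M →ₗ[R] F) (hp : Function.Surjective p) (hdp : Function.Exact d p)
    (φ : P →ₗ[R] H) (hφ : LinearMap.ker d ≤ LinearMap.ker φ) :
    ∃ ψ : M →ₗ[R] H, ∀ x, ψ (d x) = φ x := by
  classical
  obtain ⟨n, m, f, g, hf, hgf⟩ := Module.FinitePresentation.exists_fin' R F
  obtain ⟨q, hq⟩ := Module.projective_lifting_property p f hp
  have hpq (v) : p (q v) = f v := LinearMap.congr_fun hq v
  choose l hl using fun k : Fin m ↦ (hdp (q (g (Pi.single k 1)))).mp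
    (by rw [hpq, hgf.apply_apply_eq_zero])
  have hgc (c : Fin m → R) : g c = ∑ k, c k • g (Pi.single k 1) := by
    conv_lhs => rw [pi_eq_sum_univ' c]
    simp
  have hqc (c : Fin m → R) : q (g c) = d (∑ k, c k • l k) := by
    rw [hgc, map_sum, map_sum]
    simp [hl]
  obtain ⟨y, hy⟩ := hR.exists_solution hH n (fun k : Fin m ↦ g (Pi.single k 1))
    (fun k ↦ φ (l k)) (by
      intro c hc
      have h0 : g c = 0 := by
        rw [hgc]
        ext j
        simpa using hc j
      have : ∑ k, c k • l k ∈ LinearMap.ker φ := hφ (by rw [LinearMap.mem_ker, ← hqc, h0, map_zero])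
      simpa using this)
  set w : (Fin n → R) →ₗ[R] H := Fintype.linearCombination R y with hw
  have hwc (c : Fin m → R) : w (g c) = φ (∑ k, c k • l k) := by
    rw [hgc, map_sum, map_sum]
    refine Finset.sum_congr rfl fun k _ ↦ ?_
    rw [map_smul, map_smul, ← hy k, hw, Fintype.linearCombination_apply]
  obtain ⟨ψ, hψ⟩ := (d.coprod q).exists_comp_eq_of_surjective (by
    intro x
    obtain ⟨v, hv⟩ := hf (p x)
    obtain ⟨u, hu⟩ := (hdp (x - q v)).mp (by rw [map_sub, hpq, hv, sub_self])
    exact ⟨(u, v), by simp [hu]⟩) (φ.coprod w) (by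
    rintro ⟨u, v⟩ huv
    simp only [LinearMap.mem_ker, LinearMap.coprod_apply] at huv ⊢
    obtain ⟨c, rfl⟩ := (hgf v).mp (by
      have := congrArg p huv
      rwa [map_add, hdp.apply_apply_eq_zero, zero_add, map_zero, hpq] at this)
    rw [hwc, ← map_add]
    rw [hqc, ← map_add] at huv
    exact hφ huv)
  exact ⟨ψ, fun x ↦ by simpa using hψ (x, 0)⟩

lemma isFPInjective_of_isPInjective (hR : IsChainRing R) {H : Type u} [AddCommGroup H]
    [Module R H] (hH : IsPInjective R H) : IsFPInjective R H := by
  intro F hF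
  let P := projectiveResolution F
  refine Limits.IsZero.of_iso ?_ (P.isoExt (R := R) 1 (ModuleCat.of R H))
  rw [← HomologicalComplex.exactAt_iff_isZero_homology,
    HomologicalComplex.exactAt_iff' _ 0 1 2 (by simp) (by simp),
    ShortComplex.moduleCat_exact_iff]
  intro (φ : P.complex.X 1 ⟶ ModuleCat.of R H) hφ
  replace hφ : P.complex.d 2 1 ≫ φ = 0 := hφ
  have hex : Function.Exact (P.complex.d 2 1).hom (P.complex.d 1 0).hom :=
    (ShortComplex.ShortExact.moduleCat_exact_iff_function_exact _).mp (P.exact_succ 0)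
  have hex₀ : Function.Exact (P.complex.d 1 0).hom (P.π.f 0).hom :=
    (ShortComplex.ShortExact.moduleCat_exact_iff_function_exact _).mp P.exact₀
  have hs : Function.Surjective (P.π.f 0).hom :=
    (ModuleCat.epi_iff_surjective _).mp inferInstance
  have : Module.FinitePresentation R
    (((ChainComplex.single₀ (ModuleCat R)).obj F).X 0) := hF
  obtain ⟨ψ, hψ⟩ := hR.exists_factorization hH (P.complex.d 1 0).hom (P.π.f 0).hom hs hex₀
    φ.hom (fun x hx ↦ by
      obtain ⟨y, rfl⟩ := (hex x).mp hx
      exact LinearMap.congr_fun (congrArg ModuleCat.Hom.hom hφ) y)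
  exact ⟨ModuleCat.ofHom ψ, ModuleCat.hom_ext (LinearMap.ext hψ)⟩

/-- Let `R` be a chain ring in which `P` consists of zero-divisors. If the annihilator of some
nonzero element is principal and nonzero, then every element has a principal annihilator. -/
lemma exists_forall_mul_eq_zero_iff_dvd (hR : IsChainRing R)
    (hD : ∀ c y : R, (∀ s, s * c = 0 → s * y = 0) → c ∣ y)
    {a b : R} (ha : a ≠ 0) (hb : b ≠ 0) (hab : ∀ y, y * a = 0 ↔ b ∣ y) (c : R) :
    ∃ d, ∀ y, y * c = 0 ↔ d ∣ y := by
  have hba : b * a = 0 := (hab b).mpr dvd_rfl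
  have hann (y) (hy : y * b = 0) : a ∣ y := by
    refine hD a y fun s hs ↦ ?_
    obtain ⟨w, rfl⟩ := (hab s).mp hs
    linear_combination w * hy
  rcases hR.dvd_total a c with ⟨d, rfl⟩ | ⟨d, hd⟩
  · rcases hR.dvd_total d b with ⟨k, rfl⟩ | ⟨k, rfl⟩
    · refine ⟨k, fun y ↦ ⟨fun hy ↦ ?_, ?_⟩⟩
      · obtain ⟨z, hz⟩ := (hab (y * d)).mp (by linear_combination hy)
        rcases hR.dvd_total k (y - k * z) with h | ⟨t, ht⟩
        · exact (dvd_sub_left (dvd_mul_right k z)).mp h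
        · exact absurd (by rw [ht]; linear_combination t * hz) hb
      · rintro ⟨t, rfl⟩
        linear_combination t * hba
    · refine ⟨1, fun y ↦ ⟨fun _ ↦ one_dvd y, fun _ ↦ ?_⟩⟩
      linear_combination y * k * hba
  · refine ⟨b * d, fun y ↦ ⟨fun hy ↦ hD _ _ fun s hs ↦ ?_, ?_⟩⟩
    · obtain ⟨w, hw⟩ := hann (s * d) (by linear_combination hs)
      rcases hR.dvd_total c (s - c * w) with h | ⟨t, ht⟩
      · obtain ⟨u, rfl⟩ := (dvd_sub_left (dvd_mul_right c w)).mp h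
        linear_combination u * hy
      · refine absurd ?_ ha
        have h0 : (s - c * w) * d = 0 := by rw [sub_mul, hw, hd]; ring
        rw [hd, ht]
        linear_combination t * h0
    · rintro ⟨t, rfl⟩
      rw [hd] at hba
      linear_combination t * hba

lemma dvd_of_forall_mul_eq_zero [IsLocalRing R] (hR : IsChainRing R)
    (hP : ∀ y : R, ¬ IsUnit y → ∃ s, s ≠ 0 ∧ y * s = 0) (c y : R)
    (h : ∀ s, s * c = 0 → s * y = 0) : c ∣ y := by
  rcases hR.dvd_total c y with hcy | ⟨w, rfl⟩
  · exact hcy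
  by_cases hw : IsUnit w
  · exact (hw.mul_right_dvd).mpr dvd_rfl
  obtain ⟨s, hs, hws⟩ := hP w hw
  rcases hR.dvd_total y s with ⟨u, rfl⟩ | ⟨u, rfl⟩
  · exact absurd (by linear_combination h u (by linear_combination hws)) hs
  · have : s * u * w = 0 := by linear_combination u * hws
    simp only [this, mul_zero, forall_const] at h ⊢
    simpa using h 1

open TensorProduct in
lemma isIFRing (hR : IsChainRing R)
    (hD : ∀ c y : R, (∀ s, s * c = 0 → s * y = 0) → c ∣ y)
    (hann : ∀ c : R, ∃ d, ∀ y, y * c = 0 ↔ d ∣ y) : IsIFRing R := by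
  intro M _ _ hM
  rw [Module.Flat.iff_rTensor_injective]
  intro I hI
  obtain ⟨c, rfl⟩ := hR.exists_eq_span_singleton_of_fg hI
  let c' : Ideal.span {c} := ⟨c, Ideal.mem_span_singleton_self c⟩
  have htmul (z : Ideal.span {c} ⊗[R] M) : ∃ m : M, z = c' ⊗ₜ m := by
    induction z with
    | zero => exact ⟨0, by simp⟩
    | tmul x m =>
      obtain ⟨t, ht⟩ := Ideal.mem_span_singleton.mp x.2
      refine ⟨t • m, ?_⟩
      rw [← TensorProduct.smul_tmul]
      congr 1
      exact Subtype.ext (by simp [ht, c', mul_comm])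
    | add x y hx hy =>
      obtain ⟨m, rfl⟩ := hx
      obtain ⟨m', rfl⟩ := hy
      exact ⟨m + m', by rw [TensorProduct.tmul_add]⟩
  rw [injective_iff_map_eq_zero]
  intro z hz
  obtain ⟨m, rfl⟩ := htmul z
  have hcm : c • m = 0 := by simpa [c'] using congrArg (TensorProduct.lid R M) hz
  obtain ⟨d, hd⟩ := hann c
  obtain ⟨m', rfl⟩ := IsPInjective.of_injective hM d m fun s hs ↦ by
    obtain ⟨t, rfl⟩ := hD c s fun u hu ↦ by
      obtain ⟨v, rfl⟩ := (hd u).mp hu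
      linear_combination v * hs
    rw [mul_comm, mul_smul, hcm, smul_zero]
  have hdc : d • c' = 0 := Subtype.ext (by simpa [c'] using (hd d).mpr dvd_rfl)
  rw [← TensorProduct.smul_tmul, hdc, TensorProduct.zero_tmul]

lemma exists_torsionOf_eq_of_injective (hR : IsChainRing R) {H : Type u} [AddCommGroup H]
    [Module R H] (hH : Module.Injective R H) {r : R} (hr : r ≠ 0) (hru : ¬ IsUnit r) {x : H}
    (hx : ∀ y : R, y • x = 0 ↔ r ∣ y) {s : R} (hs : s ≠ 0) :
    ∃ h : H, Ideal.torsionOf R H h = Ideal.span {s} := by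
  rcases hR.dvd_total s r with ⟨t, rfl⟩ | ⟨t, rfl⟩
  · refine ⟨t • x, torsionOf_eq_span_singleton_of_forall ?_ fun y hy ↦ ?_⟩
    · rw [smul_smul, hx]
    · rw [smul_smul, hx] at hy
      obtain ⟨z, hz⟩ := hy
      rcases hR.dvd_total s (y - s * z) with h | ⟨k, hk⟩
      · exact (dvd_sub_left (dvd_mul_right s z)).mp h
      · exact absurd (by rw [hk]; linear_combination k * hz) hr
  · obtain ⟨h, hh⟩ := IsPInjective.of_injective hH t x fun y hy ↦ by
      rw [hx]
      rcases hR.dvd_total r y with hry | ⟨k, rfl⟩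
      · exact hry
      · exact absurd (by linear_combination k * hy) hs
    refine ⟨h, torsionOf_eq_span_singleton_of_forall ?_ fun y hy ↦ ?_⟩
    · rw [mul_smul, hh, hx]
    · rcases hR.dvd_total t y with ⟨k, rfl⟩ | ⟨k, rfl⟩
      · rw [mul_comm, mul_smul, hh, hx] at hy
        rw [mul_comm r]
        exact mul_dvd_mul_left t hy
      · refine absurd (isUnit_of_dvd_one ((hx 1).mp ?_)) hru
        rw [one_smul, ← hh, mul_comm, mul_smul, hy, smul_zero]

section Quotient

variable [IsLocalRing R] {Z : Ideal R} {E : Type u} [AddCommGroup E] [Module R E] {x : E}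

lemma exists_torsionOf_quotient_eq (hR : IsChainRing R) (hZ : (Z : Set R) = zeroDivisorsSet R)
    (hE : Module.Injective R E) (hx : Ideal.torsionOf R E x = Z) {r : R} (hr : r ≠ 0) :
    ∃ h : E ⧸ Submodule.span R {x}, Ideal.torsionOf R _ h = Ideal.span {r} := by
  have hxZ (y : R) : y • x = 0 ↔ ∃ s, s ≠ 0 ∧ y * s = 0 := by
    rw [← Ideal.mem_torsionOf_iff, hx, ← SetLike.mem_coe, hZ]
    rfl
  obtain ⟨e, rfl⟩ := IsPInjective.of_injective hE r x fun s hs ↦ (hxZ s).mpr ⟨r, hr, hs⟩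
  refine ⟨Submodule.Quotient.mk e, torsionOf_eq_span_singleton_of_forall ?_ fun y hy ↦ ?_⟩
  · rw [← Submodule.Quotient.mk_smul, Submodule.Quotient.mk_eq_zero]
    exact Submodule.mem_span_singleton_self _
  · rw [← Submodule.Quotient.mk_smul, Submodule.Quotient.mk_eq_zero,
      Submodule.mem_span_singleton] at hy
    obtain ⟨c, hc⟩ := hy
    rcases hR.dvd_total r y with h | ⟨w, rfl⟩
    · exact h
    by_cases hw : IsUnit w
    · exact (hw.mul_right_dvd).mpr dvd_rfl
    have hu : IsUnit (1 - c * w) := by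
      refine (IsLocalRing.isUnit_or_isUnit_one_sub_self (c * w)).resolve_left fun h ↦ hw ?_
      exact isUnit_of_mul_isUnit_right h
    have hye : y • e = 0 := by
      refine (hu.smul_eq_zero).mp ?_
      have : (1 - c * w) • y • e = y • e - c • (y * w) • e := by module
      rw [this, hc, sub_self]
    obtain ⟨s, hs, hs'⟩ := (hxZ 1).mp (by rw [one_smul, mul_comm, mul_smul, hye, smul_zero])
    exact absurd (by simpa using hs') hs

lemma isPInjective_quotient (hR : IsChainRing R) (hZ : (Z : Set R) = zeroDivisorsSet R)
    (hIF : ¬ IsIFRing R) (hE : Module.Injective R E) (hx : Ideal.torsionOf R E x = Z) :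
    IsPInjective R (E ⧸ Submodule.span R {x}) := by
  have hxmem (y : R) : y • x = 0 ↔ y ∈ Z := by rw [← Ideal.mem_torsionOf_iff, hx]
  have hmem (y : R) : y ∈ Z ↔ ∃ s, s ≠ 0 ∧ y * s = 0 := by
    rw [← SetLike.mem_coe, hZ]
    rfl
  have hmul {y z : R} (h : y * z ∈ Z) (hy : y ∉ Z) : z ∈ Z := by
    obtain ⟨s, hs, h⟩ := (hmem _).mp h
    refine (hmem z).mpr ⟨s, hs, ?_⟩
    by_contra h'
    exact hy ((hmem y).mpr ⟨z * s, h', by linear_combination h⟩)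
  intro a e
  induction e using Submodule.Quotient.induction_on with | _ e
  simp only [← Submodule.Quotient.mk_smul, Submodule.Quotient.mk_eq_zero,
    Submodule.mem_span_singleton]
  intro hann
  by_cases hae : ∀ s, s * a = 0 → s • e = 0
  · obtain ⟨z, rfl⟩ := IsPInjective.of_injective hE a e hae
    exact ⟨Submodule.Quotient.mk z, rfl⟩
  by_cases ha : a = 0
  · refine ⟨0, ?_⟩
    rw [smul_zero, eq_comm, Submodule.Quotient.mk_eq_zero, Submodule.mem_span_singleton]
    simpa using hann 1 (by simp [ha])
  push Not at hae
  obtain ⟨b, hba, hbe⟩ := hae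
  obtain ⟨c, hc⟩ := hann b hba
  have hcZ : c ∉ Z := fun h ↦ hbe (by rw [← hc, hxmem c |>.mpr h])
  have hbZ : b ∈ Z := (hmem b).mpr ⟨a, ha, hba⟩
  by_cases hP : ∀ y : R, ¬ IsUnit y → y ∈ Z
  · refine absurd ?_ hIF
    have hD := hR.dvd_of_forall_mul_eq_zero fun y hy ↦ (hmem y).mp (hP y hy)
    refine hR.isIFRing hD (hR.exists_forall_mul_eq_zero_iff_dvd hD ha (b := b) ?_ fun y ↦ ?_)
    · rintro rfl
      simp at hbe
    · refine ⟨fun hy ↦ ?_, ?_⟩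
      · rcases hR.dvd_total b y with h | ⟨w, rfl⟩
        · exact h
        obtain ⟨k, hk⟩ := hann y hy
        have hwk : w * k - c ∈ Z := by
          rw [← hxmem, sub_smul, mul_smul, hk, hc]
          module
        have hw : IsUnit w := by
          by_contra hw
          exact hcZ ((Submodule.sub_mem_iff_right _ (Z.mul_mem_right k (hP w hw))).mp hwk)
        exact (hw.mul_right_dvd).mpr dvd_rfl
      · rintro ⟨t, rfl⟩
        linear_combination t * hba
  · push Not at hP
    obtain ⟨q, hq, hqZ⟩ := hP
    have hcq : c * q ∉ Z := fun h ↦ hqZ (hmul h hcZ)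
    rcases hR.dvd_total (c * q) b with ⟨b', rfl⟩ | h
    · have hb' : b' * a = 0 := by
        by_contra h
        exact hcq ((hmem _).mpr ⟨b' * a, h, by linear_combination hba⟩)
      obtain ⟨k, hk⟩ := hann b' hb'
      have h1 : (1 - k * q) * c ∈ Z := by
        rw [← hxmem, mul_comm, mul_smul, sub_smul, smul_sub, one_smul, hc, mul_comm k, mul_smul q,
          hk]
        module
      have hu : IsUnit (1 - k * q) :=
        (IsLocalRing.isUnit_or_isUnit_one_sub_self (k * q)).resolve_left fun h ↦
          hq (isUnit_of_mul_isUnit_right h)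
      exact absurd ((Ideal.unit_mul_mem_iff_mem Z hu).mp h1) hcZ
    · exact absurd (Z.mem_of_dvd h hbZ) hcq

end Quotient

end IsChainRing

/-- For a chain ring `R`, the module `H` is FP-injective, and for each
nonzero `r ∈ R` there is `h ∈ H` with `(0 : h) = Rr`. -/
theorem isFPInjective_H_and_torsionOf (R : Type u) [CommRing R] [IsLocalRing R]
    (hR : IsChainRing R)
    (Z : Ideal R) (hZ : (Z : Set R) = zeroDivisorsSet R)
    (H : Type u) [AddCommGroup H] [Module R H] (hH : IsHModule R Z H) :
    IsFPInjective R H ∧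
      ∀ r : R, r ≠ 0 → ∃ h : H, Ideal.torsionOf R H h = Ideal.span {r} := by
  rcases hH with ⟨_, r, hr, hrP, i, hHinj, hi, _⟩ | ⟨hIF, E, _, _, i, x, ⟨hE, _, _⟩, hx, ⟨e⟩⟩
  · refine ⟨hR.isFPInjective_of_isPInjective (.of_injective hHinj), fun s hs ↦ ?_⟩
    refine hR.exists_torsionOf_eq_of_injective hHinj hr
      ((IsLocalRing.mem_maximalIdeal r).mp hrP) (x := i (Submodule.Quotient.mk 1)) (fun y ↦ ?_) hs
    rw [← map_smul, map_eq_zero_iff i hi, ← Submodule.Quotient.mk_smul,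
      Submodule.Quotient.mk_eq_zero, smul_eq_mul, mul_one, Ideal.mem_span_singleton]
  · refine ⟨hR.isFPInjective_of_isPInjective
      ((hR.isPInjective_quotient hZ hIF hE hx).of_equiv e), fun r hr ↦ ?_⟩
    obtain ⟨h, hh⟩ := hR.exists_torsionOf_quotient_eq hZ hE hx hr
    refine ⟨e h, ?_⟩
    rw [← hh]
    ext y
    rw [Ideal.mem_torsionOf_iff, Ideal.mem_torsionOf_iff, ← map_smul, e.map_eq_zero_iff]
end

section
/- Let G be a nonzero almost FP-injective module over a chain ring R with set of zero-divisors Z. Then G^♯ ⊆ Z, where G^♯ = {s ∈ R : sG ⊊ G}. -/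
open CategoryTheory

universe u

open Limits in
/-- If `Ext¹(X, Y) = 0`, every `1`-cocycle of a projective resolution of `X` with values in `Y`
is a coboundary. -/
lemma exists_d_comp_eq_of_isZero_ext_one {R : Type u} [CommRing R] {X Y : ModuleCat.{u} R}
    (h : IsZero (((Ext R (ModuleCat.{u} R) 1).obj (Opposite.op X)).obj Y))
    (P : ProjectiveResolution X) (φ : P.complex.X 1 ⟶ Y) (hφ : P.complex.d 2 1 ≫ φ = 0) :
    ∃ ψ : P.complex.X 0 ⟶ Y, P.complex.d 1 0 ≫ ψ = φ := by
  have h' := IsZero.of_iso h (P.isoExt (R := R) 1 Y).symm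
  rw [← HomologicalComplex.exactAt_iff_isZero_homology,
    HomologicalComplex.exactAt_iff' _ 0 1 2 (by simp) (by simp),
    ShortComplex.moduleCat_exact_iff] at h'
  exact h' φ hφ

/-- An FP-injective module is divisible by every non-zero-divisor of the ring. -/
lemma IsFPInjective.surjective_smul {R : Type u} [CommRing R] {E : Type u} [AddCommGroup E]
    [Module R E] (hE : IsFPInjective R E) {s : R} (hs : ∀ r : R, s * r = 0 → r = 0) :
    Function.Surjective fun x : E => s • x := by
  intro e
  have hfp : Module.FinitePresentation R (R ⧸ Ideal.span {s}) :=
    Module.finitePresentation_of_surjective (Ideal.span {s}).mkQ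
      (Submodule.mkQ_surjective _) (by rw [Submodule.ker_mkQ]; exact ⟨{s}, by simp⟩)
  let X : ModuleCat.{u} R := ModuleCat.of R (R ⧸ Ideal.span {s})
  let q : ModuleCat.of R R ⟶ X := ModuleCat.ofHom (Ideal.span {s}).mkQ
  have hq : Function.Surjective q := Submodule.mkQ_surjective _
  have : Epi q := (ModuleCat.epi_iff_surjective q).2 hq
  let P : ProjectiveResolution X := projectiveResolution X
  let π : P.complex.X 0 ⟶ X := P.π.f 0
  have hπd : P.complex.d 1 0 ≫ π = 0 := P.complex_d_comp_π_f_zero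
  have hdd : P.complex.d 2 1 ≫ P.complex.d 1 0 = 0 := P.complex.d_comp_d 2 1 0
  have hπ : Function.Surjective π :=
    (ModuleCat.epi_iff_surjective π).1 (inferInstanceAs (Epi (P.π.f 0)))
  have hexact : ∀ x : P.complex.X 0, π x = 0 → ∃ y, P.complex.d 1 0 y = x :=
    (ShortComplex.moduleCat_exact_iff _).1 P.exact₀
  let f : P.complex.X 0 ⟶ ModuleCat.of R R := Projective.factorThru π q
  have hf : ∀ x, q (f x) = π x := fun x =>
    ConcreteCategory.congr_hom (Projective.factorThru_comp π q) x
  have hmem : ∀ r : R, q r = 0 ↔ s ∣ r := fun r =>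
    (Submodule.Quotient.mk_eq_zero _).trans Ideal.mem_span_singleton
  have hfd : ∀ p : P.complex.X 1, s ∣ f (P.complex.d 1 0 p) := fun p => by
    rw [← hmem, hf]
    exact ConcreteCategory.congr_hom hπd p
  choose c hc using hfd
  have hinj : ∀ a b : R, s * a = s * b → a = b := fun a b hab =>
    sub_eq_zero.1 (hs _ (by rw [mul_sub, hab, sub_self]))
  let φ : P.complex.X 1 →ₗ[R] E :=
    { toFun := fun p => c p • e
      map_add' := fun x y => by
        rw [← add_smul]
        congr 1
        apply hinj
        rw [← hc, mul_add, ← hc, ← hc, map_add, map_add]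
      map_smul' := fun r x => by
        rw [RingHom.id_apply, smul_smul]
        congr 1
        apply hinj
        rw [← hc, mul_left_comm, ← hc, map_smul, map_smul, smul_eq_mul] }
  obtain ⟨ψ, hψ⟩ := exists_d_comp_eq_of_isZero_ext_one (hE X hfp) P (ModuleCat.ofHom φ) (by
    ext x
    have h0 : c (P.complex.d 2 1 x) = 0 := by
      apply hs
      rw [← hc]
      have := ConcreteCategory.congr_hom hdd x
      exact (congrArg f this).trans (map_zero _)
    exact (congrArg (· • e) h0).trans (zero_smul R e))
  obtain ⟨g, hg⟩ := hπ (q (1 : R))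
  obtain ⟨p, hp⟩ := hexact (s • g) (by
    rw [map_smul, hg, ← map_smul]
    exact (hmem _).2 ⟨1, rfl⟩)
  obtain ⟨t, ht⟩ : s ∣ (f g : R) - 1 := by
    rw [← hmem, map_sub, hf, hg, sub_self]
  have hcp : c p = 1 + s * t := by
    apply hinj
    rw [← hc, hp, map_smul, smul_eq_mul, ← ht]
    ring
  have hψp : s • ψ g = c p • e := by
    rw [← map_smul, ← hp]
    exact ConcreteCategory.congr_hom hψ p
  refine ⟨ψ g - t • e, ?_⟩
  change s • (ψ g - t • e) = e
  rw [smul_sub, hψp, hcp, add_smul, one_smul, mul_smul, add_sub_cancel_right]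

/-- If `G` is a nonzero almost FP-injective module over a chain ring `R`,
then `G^♯ ⊆ Z`. -/
theorem topSet_subset_zeroDivisors_of_almostFPInjective (R : Type u) [CommRing R]
    (hR : IsChainRing R)
    (G : Type u) [AddCommGroup G] [Module R G] [Nontrivial G]
    (hG : IsAlmostFPInjective R G) :
    topSet R G ⊆ zeroDivisorsSet R := by
  intro s hs
  by_contra hZ
  have hs' : ∀ r : R, s * r = 0 → r = 0 := fun r hr => by
    by_contra h
    exact hZ ⟨r, h, hr⟩
  obtain ⟨E, _, _, D, hE, -, ⟨i⟩⟩ := hG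
  refine hs fun g => ?_
  obtain ⟨e, rfl⟩ := (i.surjective.comp (Submodule.mkQ_surjective D)) g
  obtain ⟨x, rfl⟩ := hE.surjective_smul hs' e
  exact ⟨i (D.mkQ x), by simp⟩
end

section
/- Let G be a nonzero almost FP-injective module over a chain ring R with set of zero-divisors Z. If G_♯ ∪ G^♯ is strictly contained in Z, then G is both flat and FP-injective, and in this case G^♯ ⊆ G_♯. -/
open CategoryTheory

universe u

/-- `G` is divisible in the following sense: `x` is a multiple of `a` as soon as
it is killed by the annihilator of `a`. -/
def IsAnnDivisible (R G : Type*) [CommRing R] [AddCommGroup G] [Module R G] : Prop :=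
  ∀ (a : R) (x : G), (∀ b : R, b * a = 0 → b • x = 0) → ∃ y : G, a • y = x

/-- Every linear map on `M` vanishing on the kernel of `k : M → P` factors through `k`. -/
def FactorsThrough {R M P : Type*} [CommRing R] [AddCommGroup M] [Module R M] [AddCommGroup P]
    [Module R P] (k : M →ₗ[R] P) (G : Type*) [AddCommGroup G] [Module R G] : Prop :=
  ∀ f : M →ₗ[R] G, LinearMap.ker k ≤ LinearMap.ker f → ∃ h : P →ₗ[R] G, h ∘ₗ k = f

lemma exists_factor_rangeRestrict {R M P G : Type*} [CommRing R] [AddCommGroup M] [Module R M]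
    [AddCommGroup P] [Module R P] [AddCommGroup G] [Module R G] (k : M →ₗ[R] P) (f : M →ₗ[R] G)
    (hf : LinearMap.ker k ≤ LinearMap.ker f) :
    ∃ f₀ : LinearMap.range k →ₗ[R] G, ∀ m, f₀ ⟨k m, LinearMap.mem_range_self k m⟩ = f m := by
  refine ⟨(LinearMap.ker k).liftQ f hf ∘ₗ k.quotKerEquivRange.symm.toLinearMap, fun m => ?_⟩
  have : k.quotKerEquivRange.symm ⟨k m, LinearMap.mem_range_self k m⟩ =
      (LinearMap.ker k).mkQ m := by
    rw [LinearEquiv.symm_apply_eq]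
    rfl
  simp [this]

/-- The factorization property depends only on the presented module, not on the presentation. -/
lemma FactorsThrough.of_presentation {R M N P Q F G : Type*} [CommRing R]
    [AddCommGroup M] [Module R M] [AddCommGroup N] [Module R N]
    [AddCommGroup P] [Module R P] [AddCommGroup Q] [Module R Q]
    [AddCommGroup F] [Module R F] [AddCommGroup G] [Module R G]
    [Module.Projective R P] [Module.Projective R Q]
    {k : M →ₗ[R] P} {π : P →ₗ[R] F} {l : N →ₗ[R] Q} {ρ : Q →ₗ[R] F}
    (hk : Function.Exact k π) (hπ : Function.Surjective π)
    (hl : Function.Exact l ρ) (hρ : Function.Surjective ρ) (H : FactorsThrough k G) :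
    FactorsThrough l G := by
  intro f hf
  obtain ⟨f₀, hf₀⟩ := exists_factor_rangeRestrict l f hf
  obtain ⟨α, hα⟩ := Module.projective_lifting_property ρ π hρ
  obtain ⟨β, hβ⟩ := Module.projective_lifting_property π ρ hπ
  have hα' : ∀ p, ρ (α p) = π p := fun p => LinearMap.congr_fun hα p
  have hβ' : ∀ q, π (β q) = ρ q := fun q => LinearMap.congr_fun hβ q
  have hαk : ∀ m, (α ∘ₗ k) m ∈ LinearMap.range l := fun m => by
    refine (hl _).1 ?_
    simp [hα', hk.apply_apply_eq_zero]
  have hαβ : ∀ q, (α ∘ₗ β - LinearMap.id : Q →ₗ[R] Q) q ∈ LinearMap.range l := fun q => by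
    refine (hl _).1 ?_
    simp [hα', hβ']
  obtain ⟨h, hh⟩ := H (f₀ ∘ₗ (α ∘ₗ k).codRestrict _ hαk) (fun m hm => by
    have hm : k m = 0 := hm
    have : (α ∘ₗ k).codRestrict _ hαk m = 0 := by ext; simp [hm]
    simp [this])
  refine ⟨h ∘ₗ β - f₀ ∘ₗ (α ∘ₗ β - LinearMap.id : Q →ₗ[R] Q).codRestrict _ hαβ, ?_⟩
  ext n
  obtain ⟨m, hm⟩ := (hk (β (l n))).1 (by rw [hβ', hl.apply_apply_eq_zero])
  have h1 := LinearMap.congr_fun hh m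
  simp only [LinearMap.comp_apply, LinearMap.sub_apply] at h1 ⊢
  rw [← hm, h1, ← map_sub, ← hf₀ n]
  congr 1
  ext
  simp [← hm]

/-- `Ext¹(F, G)` vanishes iff maps to `G` factor through the first map of
a projective presentation of `F`. -/
lemma isZero_ext_one_iff_factorsThrough {R : Type u} [CommRing R] (F : ModuleCat.{u} R)
    (G : Type u) [AddCommGroup G] [Module R G] {M P : Type u} [AddCommGroup M] [Module R M]
    [AddCommGroup P] [Module R P] [Module.Projective R P] {k : M →ₗ[R] P} {π : P →ₗ[R] F}
    (hk : Function.Exact k π) (hπ : Function.Surjective π) :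
    Limits.IsZero (((Ext R (ModuleCat.{u} R) 1).obj (Opposite.op F)).obj (ModuleCat.of R G)) ↔
      FactorsThrough k G := by
  let Pr : ProjectiveResolution F := Classical.choice (HasProjectiveResolution.out (Z := F))
  have hP0 : Module.Projective R (Pr.complex.X 0) :=
    (IsProjective.iff_projective _).2 (Pr.projective 0)
  have h0 : Function.Exact (Pr.complex.d 1 0).hom (Pr.π.f 0).hom := by
    have := ShortComplex.exact_of_g_is_cokernel
      (ShortComplex.mk _ _ Pr.complex_d_comp_π_f_zero) Pr.isColimitCokernelCofork
    exact (ShortComplex.ShortExact.moduleCat_exact_iff_function_exact _).1 this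
  have hs : Function.Surjective (Pr.π.f 0).hom :=
    (ModuleCat.epi_iff_surjective _).1 inferInstance
  have h1 : Function.Exact (Pr.complex.d 2 1).hom (Pr.complex.d 1 0).hom :=
    (ShortComplex.ShortExact.moduleCat_exact_iff_function_exact _).1 (Pr.exact_succ 0)
  have key : FactorsThrough (Pr.complex.d 1 0).hom G ↔ FactorsThrough k G :=
    ⟨FactorsThrough.of_presentation h0 hs hk hπ, FactorsThrough.of_presentation hk hπ h0 hs⟩
  rw [← key, (Pr.isoExt 1 (ModuleCat.of R G)).isZero_iff,
    ← HomologicalComplex.exactAt_iff_isZero_homology,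
    HomologicalComplex.exactAt_iff' _ 0 1 2 (by simp) (by simp),
    ShortComplex.moduleCat_exact_iff]
  constructor
  · intro H f hf
    obtain ⟨(g : Pr.complex.X 0 ⟶ ModuleCat.of R G), hg⟩ := H (ModuleCat.ofHom f) (by
      change Pr.complex.d 2 1 ≫ ModuleCat.ofHom f = 0
      ext x
      exact hf (h1.apply_apply_eq_zero x))
    have hg : Pr.complex.d 1 0 ≫ g = ModuleCat.ofHom f := hg
    exact ⟨g.hom, congrArg ModuleCat.Hom.hom hg⟩
  · intro H f hf
    have hf : Pr.complex.d 2 1 ≫ f = 0 := hf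
    obtain ⟨g, hg⟩ := H f.hom (fun x hx => by
      obtain ⟨y, rfl⟩ := (h1 x).1 hx
      exact LinearMap.congr_fun (congrArg ModuleCat.Hom.hom hf) y)
    refine ⟨ModuleCat.ofHom g, ?_⟩
    change Pr.complex.d 1 0 ≫ ModuleCat.ofHom g = f
    ext x
    exact LinearMap.congr_fun hg x

lemma IsFPInjective.isAnnDivisible {R : Type u} [CommRing R] {E : Type u} [AddCommGroup E]
    [Module R E] (hE : IsFPInjective R E) : IsAnnDivisible R E := by
  intro a x hx
  have hex : Function.Exact (LinearMap.toSpanSingleton R R a) (Ideal.span {a}).mkQ := by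
    rw [LinearMap.exact_iff, Submodule.ker_mkQ, LinearMap.range_toSpanSingleton]
  have hs := (Ideal.span {a}).mkQ_surjective
  have hfp : Module.FinitePresentation R (R ⧸ Ideal.span {a}) :=
    Module.finitePresentation_of_surjective _ hs (by
      rw [Submodule.ker_mkQ]; exact ⟨{a}, by simp [Ideal.span]⟩)
  obtain ⟨h, hh⟩ := (isZero_ext_one_iff_factorsThrough
    (ModuleCat.of R (R ⧸ Ideal.span {a})) E hex hs).1 (hE _ hfp)
      (LinearMap.toSpanSingleton R E x) (fun b hb => hx b (by simpa using hb))
  refine ⟨h 1, ?_⟩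
  have := LinearMap.congr_fun hh 1
  simpa [← map_smul] using this

lemma IsChainRing.dvd_total_s11 {R : Type u} [CommRing R] (hR : IsChainRing R) (a b : R) :
    a ∣ b ∨ b ∣ a := by
  simpa only [Ideal.span_singleton_le_span_singleton, or_comm] using
    hR (Ideal.span {b}) (Ideal.span {a})

lemma IsChainRing.exists_dvd_all {R : Type u} [CommRing R] (hR : IsChainRing R) {ι : Type*}
    (s : Finset ι) (hs : s.Nonempty) (v : ι → R) : ∃ i ∈ s, ∀ j ∈ s, v i ∣ v j := by
  classical
  induction hs using Finset.Nonempty.cons_induction with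
  | singleton a => exact ⟨a, by simp⟩
  | cons a s ha hs ih =>
    obtain ⟨i, hi, h⟩ := ih
    rcases hR.dvd_total_s11 (v i) (v a) with h' | h'
    · exact ⟨i, by simp [hi], by simpa [h'] using h⟩
    · exact ⟨a, by simp, by simpa using fun j hj => h'.trans (h j hj)⟩

lemma sum_sub_single_smul {R V ι : Type*} [CommRing R] [AddCommGroup V] [Module R V] [Fintype ι]
    [DecidableEq ι] (d c : ι → R) (u : ι → V) (i₀ : ι) :
    ∑ i, (d - Pi.single i₀ (∑ i, d i * c i) : ι → R) i • u i = ∑ i, d i • (u i - c i • u i₀) := by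
  simp [sub_smul, smul_sub, Finset.sum_sub_distrib, Pi.single_apply, Finset.sum_smul, mul_smul]

/-- Over a chain ring, compatible linear systems with values in a divisible module are solvable. -/
lemma IsAnnDivisible.exists_solution {R : Type u} [CommRing R] (hR : IsChainRing R) {G : Type*}
    [AddCommGroup G] [Module R G] (hG : IsAnnDivisible R G) {ι κ : Type*} [Fintype ι]
    [Fintype κ] (S : Finset κ) (v : ι → κ → R) (g : ι → G)
    (hS : ∀ i, ∀ j ∉ S, v i j = 0)
    (hv : ∀ c : ι → R, ∑ i, c i • v i = 0 → ∑ i, c i • g i = 0) :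
    ∃ h : (κ → R) →ₗ[R] G, ∀ i, h (v i) = g i := by
  classical
  induction hn : S.card generalizing S v g with
  | zero =>
    refine ⟨0, fun i => ?_⟩
    have hv0 : v i = 0 := funext fun j => hS i j (by simp [Finset.card_eq_zero.1 hn])
    have := hv (Pi.single i 1) (by simp [Pi.single_apply, hv0])
    simpa [Pi.single_apply] using this.symm
  | succ n ih =>
    rcases isEmpty_or_nonempty ι with hι | hι
    · exact ⟨0, isEmptyElim⟩
    obtain ⟨⟨i₀, j₀⟩, hij, hdvd⟩ := hR.exists_dvd_all ((Finset.univ : Finset ι) ×ˢ S)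
      (Finset.univ_nonempty.product (Finset.card_pos.1 (by omega))) (fun p => v p.1 p.2)
    have hj₀ : j₀ ∈ S := by simpa using hij
    have hdvd : ∀ i j, v i₀ j₀ ∣ v i j := fun i j => by
      by_cases hj : j ∈ S
      · exact hdvd (i, j) (by simp [hj])
      · simp [hS i j hj]
    set p := v i₀ j₀ with hp
    choose c hc using fun i => hdvd i j₀
    choose w hw using fun j => hdvd i₀ j
    obtain ⟨h', hh'⟩ := ih (S.erase j₀) (fun i => v i - c i • v i₀) (fun i => g i - c i • g i₀)
      (fun i j hj => by
        by_cases hjj : j = j₀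
        · subst hjj
          simp [hc i, mul_comm, ← hp]
        · have : j ∉ S := fun h => hj (by simp [h, hjj])
          simp [hS _ j this])
      (fun d hd => by
        rw [← sum_sub_single_smul] at hd ⊢
        exact hv _ hd)
      (by rw [Finset.card_erase_of_mem hj₀]; omega)
    obtain ⟨y, hy⟩ := hG p (g i₀) (fun b hb => by
      have := hv (Pi.single i₀ b) (by
        have hsum : ∑ i, (Pi.single i₀ b : ι → R) i • v i = b • v i₀ := by simp [Pi.single_apply]
        rw [hsum]
        ext j
        simp [hw j, ← mul_assoc, hb])
      simpa [Pi.single_apply] using this)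
    have hvw : v i₀ = p • w := funext hw
    let h : (κ → R) →ₗ[R] G := h' + (LinearMap.proj j₀).smulRight (y - h' w)
    have hh0 : h (v i₀) = g i₀ := by
      have : (p • w) j₀ = p := by rw [← hvw]
      simp only [h, LinearMap.add_apply, LinearMap.smulRight_apply, LinearMap.proj_apply]
      rw [hvw, this, map_smul, smul_sub, hy]
      abel
    refine ⟨h, fun i => ?_⟩
    have h2 : h (v i - c i • v i₀) = g i - c i • g i₀ := by
      rw [← hh' i]
      simp [h, hc i, mul_comm, ← hp]
    rw [map_sub, map_smul, hh0] at h2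
    exact sub_left_injective h2

lemma IsAnnDivisible.isFPInjective {R : Type u} [CommRing R] (hR : IsChainRing R) {G : Type u}
    [AddCommGroup G] [Module R G] (hG : IsAnnDivisible R G) : IsFPInjective R G := by
  intro F hF
  obtain ⟨n, ρ, hρ⟩ := Module.Finite.exists_fin' R F
  obtain ⟨m, v, hv⟩ := Submodule.fg_iff_exists_fin_generating_family.1
    (Module.FinitePresentation.fg_ker ρ hρ)
  have hex : Function.Exact (Fintype.linearCombination R v) ρ := by
    rw [LinearMap.exact_iff, ← hv, Fintype.range_linearCombination]
  rw [isZero_ext_one_iff_factorsThrough F G hex hρ]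
  intro f hf
  have hsum : ∀ c : Fin m → R, ∑ i, c i • f (Pi.single i 1) = f c := fun c =>
    (LinearMap.pi_apply_eq_sum_univ f c).symm ▸ by
      congr! 3
      ext j
      simp [Pi.single_apply, eq_comm]
  obtain ⟨h, hh⟩ := hG.exists_solution hR Finset.univ v (fun i => f (Pi.single i 1))
    (by simp) (fun c hc => by
      rw [hsum]
      exact hf hc)
  refine ⟨h, ?_⟩
  ext i
  simp [hh]

lemma IsPureSubmodule.exists_smul_eq {R : Type u} [CommRing R] {E : Type u} [AddCommGroup E]
    [Module R E] {D : Submodule R E} (hD : IsPureSubmodule D) {a : R} {e : E} (h : a • e ∈ D) :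
    ∃ d ∈ D, a • d = a • e := by
  have h1 : (⟨a • e, h⟩ : D) ⊗ₜ[R] (Ideal.Quotient.mk (Ideal.span {a}) 1) = 0 := by
    apply hD (R ⧸ Ideal.span {a})
    have : a • (Ideal.Quotient.mk (Ideal.span {a}) 1) = 0 := by
      refine Ideal.Quotient.eq_zero_iff_mem.2 ?_
      simp
    simp only [LinearMap.rTensor_tmul, Submodule.subtype_apply, map_zero]
    rw [TensorProduct.smul_tmul, this, TensorProduct.tmul_zero]
  have h2 := congrArg (TensorProduct.tensorQuotEquivQuotSMul D (Ideal.span {a})) h1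
  rw [TensorProduct.tensorQuotEquivQuotSMul_tmul_mk, map_zero, one_smul,
    Submodule.Quotient.mk_eq_zero, Submodule.ideal_span_singleton_smul,
    Submodule.mem_smul_pointwise_iff_exists] at h2
  obtain ⟨d, -, hd⟩ := h2
  exact ⟨d, d.2, congrArg Subtype.val hd⟩

lemma IsChainRing.exists_eq_span_singleton {R : Type u} [CommRing R] (hR : IsChainRing R)
    {I : Ideal R} (hI : I.FG) : ∃ a, I = Ideal.span {a} := by
  obtain ⟨s, rfl⟩ := hI
  rcases s.eq_empty_or_nonempty with rfl | hs
  · exact ⟨0, by simp⟩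
  obtain ⟨a, ha, h⟩ := hR.exists_dvd_all s hs id
  refine ⟨a, le_antisymm (Ideal.span_le.2 fun b hb => Ideal.mem_span_singleton.2 (h b hb)) ?_⟩
  exact Ideal.span_mono (by simpa using ha)

lemma flat_of_forall_smul_eq_zero {R : Type u} [CommRing R] (hR : IsChainRing R) {G : Type u}
    [AddCommGroup G] [Module R G]
    (hG : ∀ (a : R) (x : G), a • x = 0 → ∃ b : R, ∃ y : G, a * b = 0 ∧ b • y = x) :
    Module.Flat R G := by
  rw [Module.Flat.iff_rTensor_injective]
  intro I hI
  obtain ⟨a, rfl⟩ := hR.exists_eq_span_singleton hI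
  rw [injective_iff_map_eq_zero]
  intro t
  obtain ⟨x, rfl⟩ : ∃ x : G,
      t = (⟨a, Ideal.mem_span_singleton_self a⟩ : Ideal.span {a}) ⊗ₜ[R] x := by
    induction t with
    | zero => exact ⟨0, by simp⟩
    | tmul r x =>
      obtain ⟨r, hr⟩ := r
      obtain ⟨c, rfl⟩ := Ideal.mem_span_singleton.1 hr
      refine ⟨c • x, ?_⟩
      rw [← TensorProduct.smul_tmul]
      congr 1
      ext
      simp [mul_comm]
    | add s t hs ht =>
      obtain ⟨x, rfl⟩ := hs
      obtain ⟨y, rfl⟩ := ht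
      exact ⟨x + y, (TensorProduct.tmul_add _ _ _).symm⟩
  intro ht
  have hax : a • x = 0 := by
    simpa using congrArg (TensorProduct.lid R G) ht
  obtain ⟨b, y, hab, rfl⟩ := hG a x hax
  rw [← TensorProduct.smul_tmul]
  have hba : b • (⟨a, Ideal.mem_span_singleton_self a⟩ : Ideal.span {a}) = 0 := by
    ext
    simpa [mul_comm] using hab
  rw [hba, TensorProduct.zero_tmul]

/-- Over a chain ring with a zero-divisor `s`, the annihilator of each element `a` contains
some `b` such that `s (0 : b) ⊆ a R`, or else `s` itself. -/
lemma IsChainRing.exists_annihilator {R : Type u} [CommRing R] (hR : IsChainRing R) {s : R}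
    (hs : s ∈ zeroDivisorsSet R) (a : R) :
    ∃ b, a * b = 0 ∧ (b = s ∨ ∀ c, c * b = 0 → a ∣ s * c) := by
  obtain ⟨t, ht, hst⟩ := hs
  rcases hR.dvd_total_s11 a t with ⟨t', rfl⟩ | ⟨u, rfl⟩
  · refine ⟨s * t', by rw [← hst]; ring, Or.inr fun c hc => ?_⟩
    refine (hR.dvd_total_s11 a (s * c)).resolve_right fun ⟨m, hm⟩ => ht ?_
    rw [hm, ← zero_mul m, ← hc]
    ring
  · exact ⟨s, by rw [mul_right_comm, mul_comm t, hst, zero_mul], Or.inl rfl⟩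

/-- If `G` is a nonzero almost FP-injective module over a chain ring `R`
with `G_♯ ∪ G^♯ ⊊ Z`, then `G` is flat and FP-injective, and `G^♯ ⊆ G_♯`. -/
theorem flat_and_fpInjective_of_union_ssubset (R : Type u) [CommRing R]
    (hR : IsChainRing R)
    (G : Type u) [AddCommGroup G] [Module R G] [Nontrivial G]
    (hG : IsAlmostFPInjective R G)
    (hss : bottomSet R G ∪ topSet R G ⊂ zeroDivisorsSet R) :
    Module.Flat R G ∧ IsFPInjective R G ∧ topSet R G ⊆ bottomSet R G := by
  obtain ⟨E, _, _, D, hE, hD, ⟨e⟩⟩ := hG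
  obtain ⟨-, s, hsZ, hs⟩ := Set.ssubset_iff_exists.1 hss
  have hinj : ∀ x : G, s • x = 0 → x = 0 := fun x hx => by
    by_contra h
    exact hs (Or.inl ⟨x, h, hx⟩)
  have hsurj : Function.Surjective fun x : G => s • x := by
    by_contra h
    exact hs (Or.inr h)
  let q : E →ₗ[R] G := e.toLinearMap ∘ₗ D.mkQ
  have hq : Function.Surjective q := e.surjective.comp D.mkQ_surjective
  have hker : ∀ z, q z = 0 ↔ z ∈ D := fun z => by simp [q]
  have hlift : ∀ (a : R) (y : G), a • y = 0 → ∃ f : E, q f = y ∧ a • f = 0 := by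
    intro a y hy
    obtain ⟨z, rfl⟩ := hq y
    rw [← map_smul, hker] at hy
    obtain ⟨d, hd, hda⟩ := hD.exists_smul_eq hy
    exact ⟨z - d, by rw [map_sub, (hker d).2 hd, sub_zero], by rw [smul_sub, hda, sub_self]⟩
  have hflat : ∀ (a : R) (x : G), a • x = 0 → ∃ b : R, ∃ y : G, a * b = 0 ∧ b • y = x := by
    intro a x hx
    obtain ⟨y, rfl⟩ := hsurj x
    obtain ⟨b, hab, rfl | hb⟩ := hR.exists_annihilator hsZ a
    · exact ⟨b, y, hab, rfl⟩
    obtain ⟨f, rfl, hf⟩ := hlift a y (hinj _ (by rw [smul_comm]; exact hx))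
    obtain ⟨g, hg⟩ := hE.isAnnDivisible b (s • f) (fun c hc => by
      obtain ⟨m, hm⟩ := hb c hc
      rw [smul_smul, mul_comm, hm, mul_comm, mul_smul, hf, smul_zero])
    exact ⟨b, q g, hab, by rw [← map_smul, hg, map_smul]⟩
  have hdiv : IsAnnDivisible R G := by
    intro a x hx
    obtain ⟨b, hab, rfl | hb⟩ := hR.exists_annihilator hsZ a
    · exact ⟨0, by rw [hinj x (hx b (by rw [mul_comm, hab])), smul_zero]⟩
    obtain ⟨y, rfl⟩ := hsurj x
    obtain ⟨c, z, hbc, rfl⟩ := hflat b y (hinj _ (by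
      rw [smul_comm]
      exact hx b (by rw [mul_comm, hab])))
    obtain ⟨m, hm⟩ := hb c (by rw [mul_comm, hbc])
    exact ⟨m • z, by simp only [smul_smul, hm]⟩
  refine ⟨flat_of_forall_smul_eq_zero hR hflat, hdiv.isFPInjective hR, fun r hr => ?_⟩
  by_contra hr'
  refine hr fun x => hdiv r x fun b hb => ?_
  by_contra hbx
  exact hr' ⟨b • x, hbx, by rw [smul_smul, mul_comm, hb, zero_smul]⟩
end
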